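/- arXiv:1712.09861 — 2 statements merged into one kernel-verified Lean document; each statement's English description precedes it below -/
import Mathlib

section
/- Let p ≥ 5 be a prime, q a power of p, and n = p^2 s for some positive integer s. Then there exists an element of F_{q^n} that is simultaneously 2-primitive and 1-normal over F_q. -/
/-- The `F_q`-span of the conjugates `α, α^q, …, α^{q^{n-1}}` of `α ∈ F_{q^n}`. -/
def conjSpan (K : Type*) {L : Type*} [Field K] [Field L] [Algebra K L]
    (q n : ℕ) (α : L) : Submodule K L :=
  Submodule.span K (Set.range fun i : Fin n => α ^ q ^ (i : ℕ))

open Finset in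
/-- A nontrivial additive character sums to at most `√|F|` over any subgroup of `Fˣ`. -/
theorem norm_sq_sum_addChar_subgroup_le {F : Type*} [Field F] [Fintype F] (ψ : AddChar F ℂ)
    (hψ : ψ ≠ 0) (H : Subgroup Fˣ) [Fintype H] :
    ‖∑ h : H, ψ ((h : Fˣ) : F)‖ ^ 2 ≤ Fintype.card F := by
  classical
  set S : F → ℂ := fun a => ∑ h : H, ψ (a * ((h : Fˣ) : F)) with hS
  have hprim : ψ.IsPrimitive := AddChar.IsPrimitive.of_ne_one hψ
  have hinv : ∀ k : H, S ((k : Fˣ) : F) = S 1 := by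
    intro k
    simp only [hS, one_mul]
    refine Fintype.sum_equiv (Equiv.mulLeft k) _ _ fun h => ?_
    simp
  have hmoment : ∑ a : F, ‖S a‖ ^ 2 = Fintype.card F * Fintype.card H := by
    have h1 : ∀ a, ((‖S a‖ ^ 2 : ℝ) : ℂ)
        = ∑ h : H, ∑ k : H, ψ (a * (((h : Fˣ) : F) - ((k : Fˣ) : F))) := by
      intro a
      push_cast
      rw [← Complex.mul_conj', hS, map_sum, Finset.sum_mul_sum]
      refine Finset.sum_congr rfl fun h _ => Finset.sum_congr rfl fun k _ => ?_
      rw [← AddChar.map_neg_eq_conj, ← AddChar.map_add_eq_mul]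
      ring_nf
    have h2 : ((∑ a : F, ‖S a‖ ^ 2 : ℝ) : ℂ) = Fintype.card F * Fintype.card H := by
      push_cast
      have h3 : ∀ a, ((‖S a‖ : ℂ) ^ 2)
        = ∑ h : H, ∑ k : H, ψ (a * (((h : Fˣ) : F) - ((k : Fˣ) : F))) := by
        intro a; rw [← h1]; push_cast; rfl
      simp_rw [h3]
      rw [Finset.sum_comm]
      simp_rw [Finset.sum_comm (s := (univ : Finset F)), AddChar.sum_mulShift _ hprim, sub_eq_zero,
        Units.val_inj, Subtype.val_inj]
      simp [mul_comm]
    exact_mod_cast h2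
  have hle : ∑ h : H, ‖S ((h : Fˣ) : F)‖ ^ 2 ≤ ∑ a : F, ‖S a‖ ^ 2 := by
    have hinj : Function.Injective fun h : H => ((h : Fˣ) : F) :=
      Units.val_injective.comp Subtype.val_injective
    rw [← Finset.sum_image (s := univ) (g := fun h : H => ((h : Fˣ) : F))
      (f := fun a => ‖S a‖ ^ 2) (hinj.injOn)]
    exact Finset.sum_le_sum_of_subset_of_nonneg (subset_univ _) fun _ _ _ => by positivity
  simp_rw [hinv] at hle
  rw [hmoment, Finset.sum_const, nsmul_eq_mul, card_univ, mul_comm] at hle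
  have := le_of_mul_le_mul_right hle (by exact_mod_cast Fintype.card_pos)
  simpa [hS] using this

open Finset in
/-- Subgroups of `Fˣ` are equidistributed among the cosets of an additive subgroup. -/
theorem abs_card_subgroup_inter_coset_sub_le {F : Type*} [Field F] [Fintype F] {A : Type*}
    [AddCommGroup A] [Fintype A] [DecidableEq A] (π : F →+ A) (hπ : Function.Surjective π) (a : A)
    (H : Subgroup Fˣ) [Fintype H] :
    |∑ h : H, ((if π ((h : Fˣ) : F) = a then (1 : ℝ) else 0) - 1 / Fintype.card A)|
      ≤ √(Fintype.card F) := by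
  classical
  have hA : (0 : ℝ) < Fintype.card A := by exact_mod_cast Fintype.card_pos
  have hA' : (Fintype.card A : ℂ) ≠ 0 := by exact_mod_cast hA.ne'
  have key : ((∑ h : H,
      ((if π ((h : Fˣ) : F) = a then (1 : ℝ) else 0) - 1 / Fintype.card A) : ℝ) : ℂ)
      = (1 / Fintype.card A) * ∑ φ ∈ (univ : Finset (AddChar A ℂ)).erase 0,
          φ (-a) * ∑ h : H, φ.compAddMonoidHom π ((h : Fˣ) : F) := by
    have h1 : ∀ x : F, (((if π x = a then (1 : ℝ) else 0) - 1 / Fintype.card A : ℝ) : ℂ)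
        = (1 / Fintype.card A) * ∑ φ ∈ (univ : Finset (AddChar A ℂ)).erase 0, φ (-a) * φ (π x) := by
      intro x
      have h2 := AddChar.sum_apply_eq_ite (π x - a)
      rw [← Finset.add_sum_erase _ _ (mem_univ (0 : AddChar A ℂ))] at h2
      have h3 : ∑ φ ∈ (univ : Finset (AddChar A ℂ)).erase 0, φ (-a) * φ (π x)
          = ∑ φ ∈ (univ : Finset (AddChar A ℂ)).erase 0, φ (π x - a) := by
        refine Finset.sum_congr rfl fun φ _ => ?_
        rw [← AddChar.map_add_eq_mul]; congr 1; abel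
      rw [h3, eq_sub_of_add_eq' h2]
      simp only [sub_eq_zero, AddChar.zero_apply]
      split_ifs <;> simp [mul_sub, hA']
    rw [Complex.ofReal_sum]
    simp_rw [h1, ← Finset.mul_sum]
    rw [Finset.sum_comm]
    simp_rw [← Finset.mul_sum]
    rfl
  rw [← Real.norm_eq_abs, ← Complex.norm_real, key, norm_mul]
  have h4 : ‖∑ φ ∈ (univ : Finset (AddChar A ℂ)).erase 0,
      φ (-a) * ∑ h : H, φ.compAddMonoidHom π ((h : Fˣ) : F)‖
        ≤ Fintype.card A * √(Fintype.card F) := by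
    calc _ ≤ ∑ φ ∈ (univ : Finset (AddChar A ℂ)).erase 0, √(Fintype.card F) := by
            refine norm_sum_le_of_le _ fun φ hφ => ?_
            rw [norm_mul, AddChar.norm_apply, one_mul]
            refine Real.le_sqrt_of_sq_le (norm_sq_sum_addChar_subgroup_le _ (fun h0 => ?_) H)
            apply Finset.ne_of_mem_erase hφ
            ext y
            obtain ⟨x, rfl⟩ := hπ y
            simpa using DFunLike.congr_fun h0 x
      _ ≤ ∑ φ : AddChar A ℂ, √(Fintype.card F) :=
            Finset.sum_le_sum_of_subset_of_nonneg (subset_univ _) fun _ _ _ => by positivity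
      _ = _ := by simp
  calc _ ≤ ‖(1 / Fintype.card A : ℂ)‖ * (Fintype.card A * √(Fintype.card F)) := by gcongr
    _ = _ := by
      simp only [norm_div, norm_one, Complex.norm_natCast]
      field_simp

open Finset in
/-- Inclusion–exclusion over the primes dividing `M` for the elements of order `M`. -/
theorem abs_sum_orderOf_eq_le {G : Type*} [CommGroup G] [Fintype G] [DecidableEq G] (w : G → ℝ)
    (E : ℝ) (hE : ∀ H : Subgroup G, ∀ _ : Fintype H, |∑ h : H, w h| ≤ E) {M : ℕ} (hM : 0 < M) :
    |∑ u : G with orderOf u = M, w u| ≤ 2 ^ M.primeFactors.card * E := by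
  classical
  let H (T : Finset ℕ) : Subgroup G :=
    { carrier := {u | u ^ M = 1 ∧ ∀ l ∈ T, u ^ (M / l) = 1}
      mul_mem' := fun {x y} hx hy => by
        refine ⟨by rw [mul_pow, hx.1, hy.1, one_mul], fun l hl => ?_⟩
        rw [mul_pow, hx.2 l hl, hy.2 l hl, one_mul]
      one_mem' := by simp
      inv_mem' := fun {x} hx => by
        refine ⟨by rw [inv_pow, hx.1, inv_one], fun l hl => ?_⟩
        rw [inv_pow, hx.2 l hl, inv_one] }
  have hmem : ∀ T u, u ∈ H T ↔ u ^ M = 1 ∧ ∀ l ∈ T, u ^ (M / l) = 1 := fun _ _ => Iff.rfl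
  have hind : ∀ u : G, (if orderOf u = M then (1 : ℝ) else 0)
      = ∑ T ∈ M.primeFactors.powerset, (-1) ^ T.card * if u ∈ H T then 1 else 0 := by
    intro u
    have h1 : (if orderOf u = M then (1 : ℝ) else 0) = (if u ^ M = 1 then 1 else 0) *
        ∏ l ∈ M.primeFactors, (1 + -(if u ^ (M / l) = 1 then (1 : ℝ) else 0)) := by
      by_cases h : orderOf u = M
      · rw [if_pos h, if_pos (h ▸ pow_orderOf_eq_one u), one_mul, Finset.prod_eq_one]
        intro l hl
        have hl' := Nat.prime_of_mem_primeFactors hl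
        rw [if_neg, neg_zero, add_zero]
        refine pow_ne_one_of_lt_orderOf (Nat.div_pos (Nat.le_of_mem_primeFactors hl) hl'.pos).ne' ?_
        rw [h]
        exact Nat.div_lt_self hM hl'.one_lt
      · rw [if_neg h]
        symm
        by_cases h2 : u ^ M = 1
        · rw [if_pos h2, one_mul]
          by_contra h3
          apply h
          refine orderOf_eq_of_pow_and_pow_div_prime hM h2 fun l hl hlM h4 => h3 ?_
          exact Finset.prod_eq_zero (i := l)
            (Nat.mem_primeFactors.2 ⟨hl, hlM, hM.ne'⟩) (by simp [h4])
        · rw [if_neg h2, zero_mul]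
    rw [h1, Finset.prod_one_add, Finset.mul_sum]
    refine Finset.sum_congr rfl fun T _ => ?_
    rw [Finset.prod_neg]
    rw [mul_left_comm, Finset.prod_boole]
    congr 1
    simp only [hmem]
    split_ifs <;> simp_all
  have hsum : ∑ u : G with orderOf u = M, w u
      = ∑ T ∈ M.primeFactors.powerset, (-1) ^ T.card * ∑ h : H T, w h := by
    calc ∑ u : G with orderOf u = M, w u
        = ∑ u : G, (if orderOf u = M then (1 : ℝ) else 0) * w u := by
          simp [Finset.sum_filter]
      _ = ∑ T ∈ M.primeFactors.powerset, ∑ u : G,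
            ((-1) ^ T.card * if u ∈ H T then 1 else 0) * w u := by
          simp_rw [hind, Finset.sum_mul]
          rw [Finset.sum_comm]
      _ = _ := by
          refine Finset.sum_congr rfl fun T _ => ?_
          simp_rw [mul_assoc, ← Finset.mul_sum]
          congr 1
          simp only [ite_mul, one_mul, zero_mul]
          rw [← Finset.sum_filter]
          exact Finset.sum_subtype _ (by simp) _
  rw [hsum]
  calc _ ≤ ∑ T ∈ M.primeFactors.powerset, E := by
        refine (Finset.abs_sum_le_sum_abs _ _).trans (Finset.sum_le_sum fun T _ => ?_)
        rw [abs_mul, abs_pow, abs_neg, abs_one, one_pow, one_mul]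
        exact hE _ _
    _ = _ := by simp

/-- The nullity of a composition is at most the sum of the nullities. -/
theorem finrank_ker_mul_le {K V : Type*} [Field K] [AddCommGroup V] [Module K V]
    [FiniteDimensional K V] (f g : Module.End K V) :
    Module.finrank K (LinearMap.ker (f * g)) ≤
      Module.finrank K (LinearMap.ker f) + Module.finrank K (LinearMap.ker g) := by
  let h : LinearMap.ker (f * g) →ₗ[K] LinearMap.ker f :=
    (g.domRestrict _).codRestrict _ fun x => x.2
  rw [← LinearMap.finrank_range_add_finrank_ker h]
  refine add_le_add (Submodule.finrank_le _) ?_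
  rw [(Submodule.equivMapOfInjective _ (Submodule.injective_subtype _)
    (LinearMap.ker h)).finrank_eq]
  refine Submodule.finrank_mono ?_
  rintro _ ⟨x, hx, rfl⟩
  exact congrArg Subtype.val (LinearMap.mem_ker.1 hx)

section Frobenius

variable (K L : Type*) [Field K] [Field L] [Algebra K L] [Fintype K]

/-- The `q`-power Frobenius of `L` over `K = F_q` as a `K`-linear endomorphism. -/
noncomputable def frobeniusEnd : Module.End K L :=
  (FiniteField.frobeniusAlgHom K L).toLinearMap

variable {L} in
theorem frobeniusEnd_pow_apply (i : ℕ) (x : L) :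
    (frobeniusEnd K L ^ i) x = x ^ Fintype.card K ^ i := by
  rw [Module.End.coe_pow]
  exact congrFun (pow_iterate (Fintype.card K) i) x

variable [Fintype L]

theorem frobeniusEnd_pow_finrank : frobeniusEnd K L ^ Module.finrank K L = 1 := by
  ext x
  rw [frobeniusEnd_pow_apply, ← Module.card_eq_pow_finrank, FiniteField.pow_card]
  rfl

theorem finrank_ker_frobeniusEnd_pow_sub_one_le {s : ℕ} (hs : s ≠ 0) :
    Module.finrank K (LinearMap.ker (frobeniusEnd K L ^ s - 1)) ≤ s := by
  classical
  have hq : 1 < Fintype.card K := Fintype.one_lt_card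
  have hqs : 1 < Fintype.card K ^ s := Nat.one_lt_pow hs hq
  rw [← Nat.pow_le_pow_iff_right hq, ← Nat.card_eq_fintype_card, ← Module.natCard_eq_pow_finrank]
  have hne := FiniteField.X_pow_card_sub_X_ne_zero L hqs
  have hsub : ((LinearMap.ker (frobeniusEnd K L ^ s - 1) : Submodule K L) : Set L) ⊆
      ((Polynomial.X ^ Fintype.card K ^ s - Polynomial.X : Polynomial L).roots.toFinset : Set L) := by
    intro x hx
    have hx' : x ^ Fintype.card K ^ s - x = 0 := by
      simpa [frobeniusEnd_pow_apply] using LinearMap.mem_ker.1 hx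
    simpa [hne] using hx'
  calc Nat.card (LinearMap.ker (frobeniusEnd K L ^ s - 1))
      ≤ (Polynomial.X ^ Fintype.card K ^ s - Polynomial.X : Polynomial L).roots.toFinset.card := by
        rw [← Set.ncard_coe_finset]
        exact Set.ncard_le_ncard hsub (Set.toFinite _)
    _ ≤ _ := (Multiset.toFinset_card_le _).trans (Polynomial.card_roots' _)
    _ = Nat.card K ^ s := by
        rw [FiniteField.X_pow_card_sub_X_natDegree_eq L hqs, Nat.card_eq_fintype_card]

theorem finrank_ker_frobeniusEnd_sub_one :
    Module.finrank K (LinearMap.ker (frobeniusEnd K L - 1)) = 1 := by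
  refine le_antisymm (pow_one (frobeniusEnd K L) ▸
    finrank_ker_frobeniusEnd_pow_sub_one_le K L one_ne_zero) ?_
  have h1 : (1 : L) ∈ LinearMap.ker (frobeniusEnd K L - 1) := by
    have := frobeniusEnd_pow_apply K 1 (1 : L)
    simp only [pow_one, one_pow] at this
    simp [this]
  exact Module.finrank_pos_iff_exists_ne_zero.2
    ⟨⟨1, h1⟩, fun h => one_ne_zero (congrArg Subtype.val h)⟩

theorem card_quotient_range_frobeniusEnd_sq_le {s : ℕ} (hs : s ≠ 0) :
    Nat.card (L ⧸ LinearMap.range ((frobeniusEnd K L ^ s - 1) ^ 2)) ≤ Fintype.card K ^ (2 * s) := by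
  set T := (frobeniusEnd K L ^ s - 1) ^ 2 with hT
  rw [Module.natCard_eq_pow_finrank (K := K), Nat.card_eq_fintype_card]
  refine Nat.pow_le_pow_right Fintype.card_pos ?_
  have h1 := Submodule.finrank_quotient_add_finrank (LinearMap.range T)
  have h2 := LinearMap.finrank_range_add_finrank_ker T
  have h3 := finrank_ker_mul_le (frobeniusEnd K L ^ s - 1) (frobeniusEnd K L ^ s - 1)
  rw [← sq, ← hT] at h3
  have h4 := finrank_ker_frobeniusEnd_pow_sub_one_le K L hs
  omega

theorem exists_conjSpan_eq_top :
    ∃ b : L, conjSpan K (Fintype.card K) (Module.finrank K L) b = ⊤ := by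
  refine ⟨IsGalois.normalBasis K L 1, ?_⟩
  rw [eq_top_iff, ← (IsGalois.normalBasis K L).span_eq, conjSpan]
  refine Submodule.span_mono ?_
  rintro _ ⟨e, rfl⟩
  obtain ⟨i, rfl⟩ := (FiniteField.bijective_frobeniusAlgEquivOfAlgebraic_pow K L).2 e
  refine ⟨i, ?_⟩
  rw [IsGalois.normalBasis_apply (e := FiniteField.frobeniusAlgEquivOfAlgebraic K L ^ (i : ℕ)),
    AlgEquiv.coe_pow, FiniteField.coe_frobeniusAlgEquivOfAlgebraic_iterate]

open Polynomial in
theorem conjSpan_aeval_frobeniusEnd {b : L}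
    (hb : conjSpan K (Fintype.card K) (Module.finrank K L) b = ⊤) (f : K[X]) :
    conjSpan K (Fintype.card K) (Module.finrank K L) (aeval (frobeniusEnd K L) f b)
      = LinearMap.range (aeval (frobeniusEnd K L) f) := by
  rw [LinearMap.range_eq_map, ← hb, conjSpan, conjSpan, Submodule.map_span, ← Set.range_comp]
  congr 2
  ext i
  have hcomm : Commute (frobeniusEnd K L ^ (i : ℕ)) (aeval (frobeniusEnd K L) f) := by
    have := Commute.all (X ^ (i : ℕ)) f
    simpa using this.map (aeval (R := K) (frobeniusEnd K L))
  simp only [Function.comp_apply, ← frobeniusEnd_pow_apply]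
  exact LinearMap.congr_fun hcomm.eq b

open Polynomial in
theorem exists_aeval_frobeniusEnd_eq {b : L}
    (hb : conjSpan K (Fintype.card K) (Module.finrank K L) b = ⊤) (c : L) :
    ∃ g : K[X], aeval (frobeniusEnd K L) g b = c := by
  let ev : K[X] →ₗ[K] L :=
    (LinearMap.applyₗ b).comp (aeval (R := K) (frobeniusEnd K L)).toLinearMap
  suffices h : LinearMap.range ev = ⊤ from LinearMap.range_eq_top.1 h c
  rw [eq_top_iff, ← hb, conjSpan, Submodule.span_le]
  rintro _ ⟨i, rfl⟩
  exact ⟨X ^ (i : ℕ), by simp [ev, frobeniusEnd_pow_apply]⟩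

open Polynomial in
/-- When `p²s = [L : K]`, some coset of the range of `(σ^s - 1)²`, with `σ` the Frobenius, consists
of `1`-normal elements. -/
theorem exists_coset_finrank_conjSpan (p s : ℕ) [Fact p.Prime] [CharP K p]
    (hn : Module.finrank K L = p ^ 2 * s) :
    ∃ a : L, ∀ c : L, Module.finrank K (conjSpan K (Fintype.card K) (Module.finrank K L)
      (a + ((frobeniusEnd K L ^ s - 1) ^ 2 : Module.End K L) c)) = Module.finrank K L - 1 := by
  obtain ⟨b, hb⟩ := exists_conjSpan_eq_top K L
  set σ := frobeniusEnd K L with hσ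
  refine ⟨(σ - 1) b, fun c => ?_⟩
  obtain ⟨g, rfl⟩ := exists_aeval_frobeniusEnd_eq K L hb c
  set N : K[X] := (X ^ s - 1) * ((∑ i ∈ Finset.range s, X ^ i) * g) with hN
  have hfac : (X - 1 : K[X]) + (X ^ s - 1) ^ 2 * g = (1 + N) * (X - 1) := by
    have := geom_sum_mul (X : K[X]) s
    linear_combination (X ^ s - 1) * g * (-this)
  have hα : (σ - 1) b + ((σ ^ s - 1) ^ 2 : Module.End K L) (aeval σ g b)
      = aeval σ ((1 + N) * (X - 1)) b := by
    rw [← hfac]; simp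
  have hnil : IsNilpotent (aeval σ N) := by
    refine ⟨p ^ 2, ?_⟩
    have h0 : aeval σ ((X ^ s - 1 : K[X]) ^ p ^ 2) = 0 := by
      rw [sub_pow_char_pow, ← pow_mul, mul_comm, ← hn, one_pow]
      simp [hσ, frobeniusEnd_pow_finrank]
    rw [← map_pow, hN, mul_pow, map_mul, h0, zero_mul]
  have hunit : IsUnit (aeval σ (1 + N)) := by
    rw [map_add, map_one]
    exact hnil.isUnit_one_add
  rw [hα, conjSpan_aeval_frobeniusEnd K L hb, map_mul, Module.End.mul_eq_comp, LinearMap.range_comp]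
  have hinj : Function.Injective (aeval σ (1 + N)) := ((Module.End.isUnit_iff _).1 hunit).1
  rw [← (Submodule.equivMapOfInjective _ hinj _).finrank_eq]
  have h1 := LinearMap.finrank_range_add_finrank_ker (σ - 1)
  rw [finrank_ker_frobeniusEnd_sub_one] at h1
  have h2 : aeval σ (X - 1 : K[X]) = σ - 1 := by simp
  rw [h2]
  omega

end Frobenius

theorem prod_primes_eight_mul_sq_div_le (P : Finset ℕ) (hP : ∀ l ∈ P, l.Prime) :
    ∏ l ∈ P, (8 * (l : ℝ) ^ 2 / ((l : ℝ) - 1) ^ 3) ≤ 1634 := by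
  set f : ℕ → ℝ := fun l => 8 * (l : ℝ) ^ 2 / ((l : ℝ) - 1) ^ 3 with hf
  set S : Finset ℕ := {2, 3, 5, 7} with hS
  have hpos : ∀ l ∈ P, 0 ≤ f l := fun l hl => by
    have : (1 : ℝ) ≤ l := by exact_mod_cast (hP l hl).one_le
    have : (0 : ℝ) ≤ l - 1 := by linarith
    simp only [hf]; positivity
  have hlarge : ∀ l ∈ P, l ∉ S → f l ≤ 1 := by
    intro l hl hlS
    have hl11 : 11 ≤ l := by
      by_contra! h
      have := hP l hl
      interval_cases l <;> simp_all +decide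
    have h11 : (11 : ℝ) ≤ l := by exact_mod_cast hl11
    have : (0 : ℝ) < l - 1 := by linarith
    simp only [hf]
    rw [div_le_one (by positivity)]
    nlinarith [mul_nonneg (sub_nonneg.2 h11) (sub_nonneg.2 h11), pow_nonneg (sub_nonneg.2 h11) 3]
  have hsmall : ∀ l ∈ S, 1 ≤ f l := by
    intro l hl
    simp only [hS, Finset.mem_insert, Finset.mem_singleton] at hl
    rcases hl with rfl | rfl | rfl | rfl <;> norm_num [hf]
  calc ∏ l ∈ P, f l = (∏ l ∈ P with l ∈ S, f l) * ∏ l ∈ P with l ∉ S, f l :=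
        (Finset.prod_filter_mul_prod_filter_not _ _ _).symm
    _ ≤ (∏ l ∈ P with l ∈ S, f l) * 1 := by
        gcongr
        · exact Finset.prod_nonneg fun l hl => hpos l (Finset.mem_filter.1 hl).1
        · exact Finset.prod_le_one (fun l hl => hpos l (Finset.mem_filter.1 hl).1)
            fun l hl => hlarge l (Finset.mem_filter.1 hl).1 (Finset.mem_filter.1 hl).2
    _ ≤ (∏ l ∈ P with l ∈ S, f l) * ∏ l ∈ S \ {l ∈ P | l ∈ S}, f l := by
        gcongr
        · exact Finset.prod_nonneg fun l hl => hpos l (Finset.mem_filter.1 hl).1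
        · rw [← Finset.prod_const_one (s := S \ {l ∈ P | l ∈ S})]
          exact Finset.prod_le_prod (fun _ _ => zero_le_one)
            fun l hl => hsmall l (Finset.mem_sdiff.1 hl).1
    _ = ∏ l ∈ S, f l := by
        rw [mul_comm]
        exact Finset.prod_sdiff fun l hl => (Finset.mem_filter.1 hl).2
    _ ≤ 1634 := by norm_num [hS, hf]

theorem sq_mul_eight_pow_card_primeFactors_le (M : ℕ) (hM : 0 < M) :
    (M : ℝ) ^ 2 * 8 ^ M.primeFactors.card ≤ 1634 * (M.totient : ℝ) ^ 3 := by
  set R : ℝ := ∏ l ∈ M.primeFactors, (l : ℝ) with hR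
  set D : ℝ := ∏ l ∈ M.primeFactors, ((l : ℝ) - 1) with hD
  have hl1 : ∀ l ∈ M.primeFactors, (1 : ℝ) < l := fun l hl => by
    exact_mod_cast (Nat.prime_of_mem_primeFactors hl).one_lt
  have hRpos : 0 < R := Finset.prod_pos fun l hl => by linarith [hl1 l hl]
  have hDpos : 0 < D := Finset.prod_pos fun l hl => by linarith [hl1 l hl]
  have hMpos : (0 : ℝ) < M := by exact_mod_cast hM
  have hRM : R ≤ M := by
    have := Nat.le_of_dvd hM (Nat.prod_primeFactors_dvd M)
    calc R = ((∏ l ∈ M.primeFactors, l : ℕ) : ℝ) := by rw [hR, Nat.cast_prod]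
      _ ≤ M := Nat.cast_le.2 this
  have hφ : (M.totient : ℝ) * R = M * D := by
    have h := congrArg (Nat.cast (R := ℝ)) (Nat.totient_mul_prod_primeFactors M)
    push_cast at h
    rw [hR, h, hD]
    congr 1
    refine Finset.prod_congr rfl fun l hl => ?_
    rw [Nat.cast_sub (Nat.prime_of_mem_primeFactors hl).one_le, Nat.cast_one]
  have hkey : 8 ^ M.primeFactors.card * R ^ 2 ≤ 1634 * D ^ 3 := by
    have h := prod_primes_eight_mul_sq_div_le M.primeFactors
      fun l hl => Nat.prime_of_mem_primeFactors hl
    rw [Finset.prod_div_distrib, Finset.prod_mul_distrib, Finset.prod_const, Finset.prod_pow,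
      Finset.prod_pow, div_le_iff₀ (by positivity)] at h
    exact h
  refine le_of_mul_le_mul_right ?_ (pow_pos hRpos 3)
  calc (M : ℝ) ^ 2 * 8 ^ M.primeFactors.card * R ^ 3
      = M ^ 2 * R * (8 ^ M.primeFactors.card * R ^ 2) := by ring
    _ ≤ M ^ 2 * M * (1634 * D ^ 3) := by gcongr
    _ = 1634 * (M * D) ^ 3 := by ring
    _ = 1634 * (M.totient : ℝ) ^ 3 * R ^ 3 := by rw [← hφ]; ring

theorem two_pow_card_primeFactors_mul_lt_totient {q n s : ℕ} (hq : 5 ≤ q) (hodd : Odd q)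
    (hs : 1 ≤ s) (hn : 25 * s ≤ n) :
    (2 : ℝ) ^ ((q ^ n - 1) / 2).primeFactors.card * √((q : ℝ) ^ n) * (q : ℝ) ^ (2 * s)
      < ((q ^ n - 1) / 2).totient := by
  set M := (q ^ n - 1) / 2 with hM
  set Y : ℝ := (q : ℝ) ^ n with hY
  have hq5 : (5 : ℝ) ≤ q := by exact_mod_cast hq
  have h1 : (5 : ℝ) ^ 13 ≤ (q : ℝ) ^ (13 * s) :=
    (pow_le_pow_left₀ (by norm_num) hq5 13).trans
      (pow_le_pow_right₀ (by linarith) (by omega))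
  have h2 : (q : ℝ) ^ (12 * s) * 5 ^ 13 ≤ Y := by
    calc (q : ℝ) ^ (12 * s) * 5 ^ 13 ≤ (q : ℝ) ^ (12 * s) * (q : ℝ) ^ (13 * s) := by gcongr
      _ = (q : ℝ) ^ (25 * s) := by rw [← pow_add]; congr 1; ring
      _ ≤ Y := pow_le_pow_right₀ (by linarith) hn
  have hQ1 : (1 : ℝ) ≤ (q : ℝ) ^ (12 * s) := one_le_pow₀ (by linarith)
  have hMY : (M : ℝ) = (Y - 1) / 2 := by
    obtain ⟨k, hk⟩ := hodd.pow (n := n)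
    have hMk : M = k := by omega
    have : Y = 2 * k + 1 := by rw [hY]; exact_mod_cast hk
    rw [hMk, this]; ring
  have hY0 : 0 < Y := by nlinarith
  have hM3 : Y / 3 ≤ M := by rw [hMY]; nlinarith
  have hMpos : 0 < M := by
    have : (0 : ℝ) < M := by linarith
    exact_mod_cast this
  have h3 := sq_mul_eight_pow_card_primeFactors_le M hMpos
  set W : ℝ := 2 ^ M.primeFactors.card with hW
  have hWpos : 0 < W := by positivity
  have h8 : (8 : ℝ) ^ M.primeFactors.card = W ^ 3 := by
    rw [hW, ← pow_mul, mul_comm, pow_mul]; norm_num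
  rw [h8] at h3
  refine lt_of_pow_lt_pow_left₀ 6 (by positivity) ?_
  have h4 : (W * √Y * (q : ℝ) ^ (2 * s)) ^ 6 = W ^ 6 * Y ^ 3 * (q : ℝ) ^ (12 * s) := by
    rw [mul_pow, mul_pow, ← pow_mul (q : ℝ), show 2 * s * 6 = 12 * s by ring,
      show √Y ^ 6 = (√Y ^ 2) ^ 3 by ring, Real.sq_sqrt hY0.le]
  rw [h4]
  have h5 : (Y / 3) ^ 2 * W ^ 3 ≤ 1634 * (M.totient : ℝ) ^ 3 :=
    le_trans (by gcongr) h3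
  have h6 : ((Y / 3) ^ 2 * W ^ 3) ^ 2 ≤ (1634 * (M.totient : ℝ) ^ 3) ^ 2 := by gcongr
  have h7 : 1634 ^ 2 * (q : ℝ) ^ (12 * s) < Y / 81 := by nlinarith
  have h9 : 1634 ^ 2 * (W ^ 6 * Y ^ 3 * (q : ℝ) ^ (12 * s)) < 1634 ^ 2 * (M.totient : ℝ) ^ 6 := by
    calc 1634 ^ 2 * (W ^ 6 * Y ^ 3 * (q : ℝ) ^ (12 * s))
        = W ^ 6 * Y ^ 3 * (1634 ^ 2 * (q : ℝ) ^ (12 * s)) := by ring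
      _ < W ^ 6 * Y ^ 3 * (Y / 81) := by gcongr
      _ = ((Y / 3) ^ 2 * W ^ 3) ^ 2 := by ring
      _ ≤ (1634 * (M.totient : ℝ) ^ 3) ^ 2 := h6
      _ = _ := by ring
  exact lt_of_mul_lt_mul_left h9 (by norm_num)

/-- Let `p ≥ 5` be prime, `q` a power of `p`, and `n = p² s` with `s ≥ 1`. Then there exists
an element of `F_{q^n}` that is simultaneously `2`-primitive and `1`-normal over `F_q`. -/
theorem stmt_7 (p t q n s : ℕ) (hp : p.Prime) (hp5 : 5 ≤ p) (ht : 1 ≤ t) (hq : q = p ^ t)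
    (hs : 1 ≤ s) (hn : n = p ^ 2 * s)
    (K L : Type*) [Field K] [Field L] [Algebra K L] [Fintype K] [Fintype L]
    (hK : Fintype.card K = q) (hL : Fintype.card L = q ^ n) :
    ∃ α : L, orderOf α = (q ^ n - 1) / 2 ∧
      Module.finrank K (conjSpan K q n α) = n - 1 := by
  classical
  have : Fact p.Prime := ⟨hp⟩
  have hq5 : 5 ≤ q := by
    rw [hq]
    exact hp5.trans (Nat.le_self_pow (by omega) p)
  have hodd : Odd q := by
    rw [hq]
    exact (hp.odd_of_ne_two (by omega)).pow
  have hn25 : 25 * s ≤ n := by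
    rw [hn]
    gcongr
    nlinarith
  have hfin : Module.finrank K L = n := by
    have h := Module.card_eq_pow_finrank (K := K) (V := L)
    rw [hL, hK] at h
    exact (Nat.pow_right_injective (by omega) h).symm
  have : CharP K p := charP_of_card_eq_prime_pow (hK.trans hq)
  obtain ⟨a, ha⟩ := exists_coset_finrank_conjSpan K L p s (hfin.trans hn)
  rw [hfin, hK] at ha
  set T : Module.End K L := (frobeniusEnd K L ^ s - 1) ^ 2 with hT
  have : Fintype (L ⧸ LinearMap.range T) := Fintype.ofFinite _
  set A := L ⧸ LinearMap.range T with hA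
  let π : L →+ A := (LinearMap.range T).mkQ.toAddMonoidHom
  have hcard : (Fintype.card A : ℝ) ≤ (q : ℝ) ^ (2 * s) := by
    have h := card_quotient_range_frobeniusEnd_sq_le K L (s := s) (by omega)
    rw [Nat.card_eq_fintype_card, hK] at h
    exact_mod_cast h
  set M := (q ^ n - 1) / 2 with hM
  have hnum := two_pow_card_primeFactors_mul_lt_totient hq5 hodd hs hn25
  rw [← hM] at hnum
  have hφ : 0 < M.totient := by
    have h : (0 : ℝ) < M.totient := lt_of_le_of_lt (by positivity) hnum
    exact_mod_cast h
  have hdvd : M ∣ Fintype.card Lˣ := by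
    rw [Fintype.card_units, hL]
    refine Nat.div_dvd_of_dvd ?_
    obtain ⟨k, hk⟩ := hodd.pow (n := n)
    exact ⟨k, by omega⟩
  by_cases hex : ∃ u : Lˣ, orderOf u = M ∧ π u = π a
  · obtain ⟨u, hu, hua⟩ := hex
    refine ⟨u, by rw [orderOf_units, hu], ?_⟩
    obtain ⟨c, hc⟩ := (Submodule.Quotient.eq (LinearMap.range T)).1 hua
    rw [show (u : L) = a + T c by rw [hc]; ring]
    exact ha c
  · exfalso
    push Not at hex
    have hsieve := abs_sum_orderOf_eq_le
      (fun u : Lˣ => (if π (u : L) = π a then (1 : ℝ) else 0) - 1 / Fintype.card A)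
      (√(Fintype.card L))
      (fun H _ => abs_card_subgroup_inter_coset_sub_le π (Submodule.mkQ_surjective _) (π a) H)
      (Nat.totient_pos.1 hφ)
    have hsum : ∑ u : Lˣ with orderOf u = M,
        ((if π (u : L) = π a then (1 : ℝ) else 0) - 1 / Fintype.card A)
        = -(M.totient / Fintype.card A) := by
      rw [Finset.sum_congr rfl (g := fun _ => -(1 / (Fintype.card A : ℝ))) fun u hu => by
        rw [if_neg (hex u (Finset.mem_filter.1 hu).2), zero_sub]]
      rw [Finset.sum_const, IsCyclic.card_orderOf_eq_totient hdvd, nsmul_eq_mul]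
      ring
    have hA0 : (0 : ℝ) < Fintype.card A := by exact_mod_cast Fintype.card_pos
    rw [hsum, abs_neg, abs_of_nonneg (by positivity), div_le_iff₀ hA0, hL] at hsieve
    push_cast at hsieve
    refine absurd (hsieve.trans ?_) hnum.not_ge
    gcongr
end

section
/- Let p ≥ 5 be a prime, q a power of p, and n = p^k u where gcd(u, p) = 1 and k ≥ 2. Then for every β ∈ F_{q^{n/p}} there exists a 2-primitive element α ∈ F_{q^n} such that Tr_{F_{q^n}/F_{q^{n/p}}}(α) = β. -/
open Finset

/-- In a field, `a ↦ a ^ e` (on units, `e > 0`) takes each value at most `e` times. -/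
theorem card_units_pow_eq_le {F : Type*} [Field F] [Fintype F] [DecidableEq F] {e : ℕ}
    (he : 0 < e) (c : F) : #{a : Fˣ | (a : F) ^ e = c} ≤ e := by
  calc #{a : Fˣ | (a : F) ^ e = c}
      ≤ (Polynomial.nthRoots e c).toFinset.card := by
        refine Finset.card_le_card_of_injOn (fun a : Fˣ => (a : F)) ?_ ?_
        · intro a ha
          simpa [Polynomial.mem_nthRoots he] using ha
        · intro a _ b _ h
          exact Units.ext h
    _ ≤ e := (Multiset.toFinset_card_le _).trans (Polynomial.card_nthRoots e c)

/-- Second moment of the power sums `z ↦ ∑ a, ψ (z * a ^ e)`. -/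
theorem sum_norm_sq_powerSum_le {F : Type*} [Field F] [Fintype F] [DecidableEq F] {ψ : AddChar F ℂ}
    (hψ : ψ.IsPrimitive) {e : ℕ} (he : 0 < e) :
    ∑ z : F, ‖∑ a : Fˣ, ψ (z * (a : F) ^ e)‖ ^ 2
      ≤ Fintype.card F * (Fintype.card Fˣ * e) := by
  have key : ∑ z : F, ((‖∑ a : Fˣ, ψ (z * (a : F) ^ e)‖ ^ 2 : ℝ) : ℂ)
      = ((Fintype.card F * ∑ b : Fˣ, #{a : Fˣ | (a : F) ^ e = (b : F) ^ e} : ℕ) : ℂ) := by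
    calc ∑ z : F, ((‖∑ a : Fˣ, ψ (z * (a : F) ^ e)‖ ^ 2 : ℝ) : ℂ)
        = ∑ z : F, ∑ b : Fˣ, ∑ a : Fˣ, ψ (z * ((a : F) ^ e - (b : F) ^ e)) := by
          refine Finset.sum_congr rfl fun z _ => ?_
          rw [Complex.ofReal_pow, ← Complex.mul_conj', map_sum, Finset.mul_sum]
          refine Finset.sum_congr rfl fun b _ => ?_
          rw [Finset.sum_mul]
          refine Finset.sum_congr rfl fun a _ => ?_
          rw [← AddChar.map_neg_eq_conj, ← AddChar.map_add_eq_mul]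
          congr 1
          ring
      _ = ∑ b : Fˣ, ∑ a : Fˣ, ∑ z : F, ψ (z * ((a : F) ^ e - (b : F) ^ e)) := by
          rw [Finset.sum_comm]
          exact Finset.sum_congr rfl fun b _ => Finset.sum_comm
      _ = _ := by
          simp_rw [AddChar.sum_mulShift _ hψ, sub_eq_zero]
          push_cast
          rw [Finset.mul_sum]
          refine Finset.sum_congr rfl fun b _ => ?_
          rw [← Finset.sum_filter, Finset.sum_const, nsmul_eq_mul, mul_comm]
  have key' : ∑ z : F, ‖∑ a : Fˣ, ψ (z * (a : F) ^ e)‖ ^ 2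
      = ((Fintype.card F * ∑ b : Fˣ, #{a : Fˣ | (a : F) ^ e = (b : F) ^ e} : ℕ) : ℝ) := by
    exact_mod_cast key
  rw [key']
  have : ∑ b : Fˣ, #{a : Fˣ | (a : F) ^ e = (b : F) ^ e} ≤ Fintype.card Fˣ * e := by
    calc _ ≤ ∑ _b : Fˣ, e := Finset.sum_le_sum fun b _ => card_units_pow_eq_le he _
      _ = _ := by simp
  exact_mod_cast Nat.mul_le_mul_left _ this

/-- A nontrivial additive character sum over nonzero `e`-th powers is at most `e * √|F|`. -/
theorem norm_powerSum_le {F : Type*} [Field F] [Fintype F] [DecidableEq F] {ψ : AddChar F ℂ}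
    (hψ : ψ ≠ 1) {e : ℕ} (he : 0 < e) :
    ‖∑ a : Fˣ, ψ ((a : F) ^ e)‖ ≤ e * √(Fintype.card F) := by
  set S : F → ℂ := fun z => ∑ a : Fˣ, ψ (z * (a : F) ^ e) with hS
  have hinv : ∀ b : Fˣ, S ((b : F) ^ e) = S 1 := by
    intro b
    refine Fintype.sum_equiv (Equiv.mulLeft b) _ _ fun a => ?_
    simp [mul_pow]
  have hcard : (0 : ℝ) < Fintype.card Fˣ := by exact_mod_cast Fintype.card_pos
  have h1 : Fintype.card Fˣ * ‖S 1‖ ^ 2 ≤ e * ∑ z : F, ‖S z‖ ^ 2 := by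
    calc Fintype.card Fˣ * ‖S 1‖ ^ 2 = ∑ b : Fˣ, ‖S ((b : F) ^ e)‖ ^ 2 := by
          simp [hinv]
      _ = ∑ z : F, ∑ b ∈ ({b | (b : F) ^ e = z} : Finset Fˣ), ‖S ((b : F) ^ e)‖ ^ 2 :=
          (Finset.sum_fiberwise Finset.univ (fun b : Fˣ => (b : F) ^ e) _).symm
      _ ≤ ∑ z : F, e * ‖S z‖ ^ 2 := by
          refine Finset.sum_le_sum fun z _ => ?_
          calc ∑ b ∈ ({b | (b : F) ^ e = z} : Finset Fˣ), ‖S ((b : F) ^ e)‖ ^ 2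
              = ∑ b ∈ ({b | (b : F) ^ e = z} : Finset Fˣ), ‖S z‖ ^ 2 :=
                Finset.sum_congr rfl fun b hb => by rw [(Finset.mem_filter.1 hb).2]
            _ = #{b : Fˣ | (b : F) ^ e = z} * ‖S z‖ ^ 2 := by simp
            _ ≤ e * ‖S z‖ ^ 2 := by
                gcongr
                exact card_units_pow_eq_le he z
      _ = _ := by rw [Finset.mul_sum]
  have h2 := sum_norm_sq_powerSum_le (AddChar.IsPrimitive.of_ne_one hψ) he
  have h3 : ‖S 1‖ ^ 2 ≤ (e : ℝ) ^ 2 * Fintype.card F := by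
    refine le_of_mul_le_mul_left ?_ hcard
    calc _ ≤ e * ∑ z : F, ‖S z‖ ^ 2 := h1
      _ ≤ e * (Fintype.card F * (Fintype.card Fˣ * e)) := by gcongr
      _ = _ := by ring
  have h4 : S 1 = ∑ a : Fˣ, ψ ((a : F) ^ e) := by simp [hS]
  rw [← h4]
  refine le_of_sq_le_sq ?_ (by positivity)
  rw [mul_pow, Real.sq_sqrt (by positivity)]
  exact h3

/-- Equidistribution of the traces of `e`-th powers of units. -/
theorem abs_card_trace_pow_eq_sub_le {M L : Type*} [Field M] [Field L] [Algebra M L]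
    [Fintype M] [Fintype L] [DecidableEq M] [DecidableEq L] (β : M) {e : ℕ} (he : 0 < e) :
    |(Fintype.card M : ℝ) * #{a : Lˣ | Algebra.trace M L ((a : L) ^ e) = β} - Fintype.card Lˣ|
      ≤ (Fintype.card M - 1) * (e * √(Fintype.card L)) := by
  have : Module.Finite M L := Module.Finite.of_finite
  set T : AddChar M ℂ → ℂ := fun ψ => ∑ a : Lˣ, ψ (Algebra.trace M L ((a : L) ^ e) - β) with hT
  have h1 : ∑ ψ : AddChar M ℂ, T ψ
      = Fintype.card M * #{a : Lˣ | Algebra.trace M L ((a : L) ^ e) = β} := by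
    rw [hT, Finset.sum_comm]
    simp_rw [AddChar.sum_apply_eq_ite, sub_eq_zero]
    rw [← Finset.sum_filter, Finset.sum_const, nsmul_eq_mul, mul_comm]
  have h2 : T 1 = Fintype.card Lˣ := by simp [hT]
  have h3 : ∀ ψ : AddChar M ℂ, ψ ≠ 1 → ‖T ψ‖ ≤ e * √(Fintype.card L) := by
    intro ψ hψ
    set Ψ : AddChar L ℂ := ψ.compAddMonoidHom (Algebra.trace M L).toAddMonoidHom with hΨ
    have hΨ1 : Ψ ≠ 1 := by
      intro h
      apply hψ
      ext x
      obtain ⟨y, rfl⟩ := Algebra.trace_surjective M L x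
      simpa [hΨ] using DFunLike.congr_fun h y
    have : T ψ = (∑ a : Lˣ, Ψ ((a : L) ^ e)) * ψ (-β) := by
      rw [hT, Finset.sum_mul]
      refine Finset.sum_congr rfl fun a _ => ?_
      rw [sub_eq_add_neg, AddChar.map_add_eq_mul]
      rfl
    rw [this, norm_mul, AddChar.norm_apply, mul_one]
    exact norm_powerSum_le hΨ1 he
  have h4 : ((Fintype.card M * #{a : Lˣ | Algebra.trace M L ((a : L) ^ e) = β}
      - Fintype.card Lˣ : ℝ) : ℂ) = ∑ ψ ∈ Finset.univ.erase 1, T ψ := by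
    push_cast
    rw [← h1, ← h2, ← Finset.add_sum_erase _ _ (Finset.mem_univ (1 : AddChar M ℂ))]
    ring
  rw [← Real.norm_eq_abs, ← Complex.norm_real, h4]
  refine (norm_sum_le_of_le _ (fun ψ hψ => h3 ψ (Finset.ne_of_mem_erase hψ))).trans ?_
  rw [Finset.sum_const, Finset.card_erase_of_mem (Finset.mem_univ _), Finset.card_univ,
    AddChar.card_eq, nsmul_eq_mul, Nat.cast_sub Fintype.card_pos, Nat.cast_one]

/-- In a finite cyclic group, an element is a `d`-th power iff `d` divides the index of the
subgroup it generates. -/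
theorem IsCyclic.mem_range_pow_iff {G : Type*} [CommGroup G] [IsCyclic G] [Fintype G] {d : ℕ}
    (hd : d ∣ Fintype.card G) (x : G) :
    x ∈ Set.range (powMonoidHom d : G →* G) ↔ d ∣ Fintype.card G / orderOf x := by
  have hx : orderOf x ∣ Fintype.card G := orderOf_dvd_card
  have hpos : 0 < Fintype.card G := Fintype.card_pos
  have hdpos : 0 < d := Nat.pos_of_dvd_of_pos hd hpos
  have h1 : d ∣ Fintype.card G / orderOf x ↔ orderOf x ∣ Fintype.card G / d := by
    rw [Nat.dvd_div_iff_mul_dvd hx, Nat.dvd_div_iff_mul_dvd hd, mul_comm]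
  rw [h1, orderOf_dvd_iff_pow_eq_one]
  constructor
  · rintro ⟨y, rfl⟩
    rw [powMonoidHom_apply, ← pow_mul, Nat.mul_div_cancel' hd, pow_card_eq_one]
  · intro h
    obtain ⟨g, hg⟩ := IsCyclic.exists_ofOrder_eq_natCard (α := G)
    have hgen : x ∈ Submonoid.powers g := mem_powers_iff_mem_zpowers.2
        ((Subgroup.eq_top_of_card_eq (Subgroup.zpowers g) (by rw [Nat.card_zpowers, hg]))
          ▸ Subgroup.mem_top x)
    obtain ⟨j, rfl⟩ := hgen
    simp only at h
    rw [← pow_mul, ← orderOf_dvd_iff_pow_eq_one, hg, Nat.card_eq_fintype_card] at h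
    obtain ⟨c, hc⟩ := hd
    rw [hc, Nat.mul_div_cancel_left _ hdpos] at h
    have hcpos : 0 < c := Nat.pos_of_ne_zero (by rintro rfl; omega)
    obtain ⟨i, rfl⟩ := Nat.dvd_of_mul_dvd_mul_right hcpos h
    exact ⟨g ^ i, by rw [powMonoidHom_apply, ← pow_mul, mul_comm]⟩

theorem IsCyclic.sum_comp_pow {G : Type*} [CommGroup G] [IsCyclic G] [Fintype G] {d : ℕ}
    (hd : d ∣ Fintype.card G) (h : G → ℝ) :
    ∑ y : G, h (y ^ d) = d * ∑ x : G with d ∣ Fintype.card G / orderOf x, h x := by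
  classical
  have hker : #{y : G | (powMonoidHom d : G →* G) y = 1} = d := by
    have := IsCyclic.card_powMonoidHom_ker (G := G) d
    rw [Nat.card_eq_fintype_card (α := G), Nat.gcd_eq_right hd] at this
    refine Eq.trans ?_ this
    rw [Nat.card_eq_fintype_card, Fintype.card_subtype]
    simp only [MonoidHom.mem_ker]
  rw [← Finset.sum_fiberwise Finset.univ (fun y : G => y ^ d), Finset.mul_sum, Finset.sum_filter]
  refine Finset.sum_congr rfl fun x _ => ?_
  have h1 : ∑ y : G with y ^ d = x, h (y ^ d) = #{y : G | (powMonoidHom d : G →* G) y = x} * h x := by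
    rw [Finset.sum_congr rfl (g := fun _ => h x)
      (fun y hy => by rw [(Finset.mem_filter.1 hy).2])]
    simp
  rw [h1]
  split_ifs with hx
  · rw [← IsCyclic.mem_range_pow_iff hd] at hx
    rw [MonoidHom.card_fiber_eq_of_mem_range _ hx ⟨1, map_one _⟩, hker]
  · rw [← IsCyclic.mem_range_pow_iff hd] at hx
    rw [Finset.filter_false_of_mem, Finset.card_empty, Nat.cast_zero, zero_mul]
    exact fun y _ hy => hx ⟨y, hy⟩

open ArithmeticFunction in
/-- Möbius detection of `m = 1` among the divisors `m` of `N`, by squarefree divisors of `N`. -/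
theorem sum_divisors_radical_moebius {N m : ℕ} (hN : N ≠ 0) (hm : m ∣ N) :
    ∑ d ∈ (∏ l ∈ N.primeFactors, l).divisors with d ∣ m, moebius d = if m = 1 then 1 else 0 := by
  set R := ∏ l ∈ N.primeFactors, l with hR
  have hR0 : R ≠ 0 := Finset.prod_ne_zero_iff.2 fun l hl => (Nat.prime_of_mem_primeFactors hl).ne_zero
  have hm0 : m ≠ 0 := ne_zero_of_dvd_ne_zero hN hm
  have h1 : R.divisors.filter (· ∣ m) = (R.gcd m).divisors := by
    ext d
    simp [Nat.dvd_gcd_iff, hR0]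
  have h2 : R.gcd m = 1 ↔ m = 1 := by
    constructor
    · intro h
      by_contra hne
      obtain ⟨l, hl, hlm⟩ := Nat.exists_prime_and_dvd hne
      have hlR : l ∣ R := Finset.dvd_prod_of_mem _ (Nat.mem_primeFactors.2 ⟨hl, hlm.trans hm, hN⟩)
      exact hl.one_lt.ne' (Nat.dvd_one.1 (h ▸ Nat.dvd_gcd hlR hlm))
    · rintro rfl
      simp
  rw [h1, ← coe_mul_zeta_apply, moebius_mul_coe_zeta, one_apply]
  simp only [h2]

/-- If `φ(N) / N` is large compared with `2 ^ ω(N)`, every element of the small field is the trace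
of the square of a primitive element. -/
theorem exists_primitive_trace_sq_eq {M L : Type*} [Field M] [Field L] [Algebra M L]
    [Fintype M] [Fintype L] [DecidableEq L] {N : ℕ} (hN : Fintype.card Lˣ = N)
    (hlt : 2 * 2 ^ #N.primeFactors * ((Fintype.card M - 1) * √(Fintype.card L))
      < N * ∏ l ∈ N.primeFactors, (1 - (l : ℝ)⁻¹)) (β : M) :
    ∃ γ : Lˣ, orderOf γ = N ∧ Algebra.trace M L ((γ : L) ^ 2) = β := by
  classical
  by_contra! hcon
  have hN0 : N ≠ 0 := hN ▸ Fintype.card_ne_zero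
  set R := ∏ l ∈ N.primeFactors, l with hR
  have hRN : R ∣ N := Nat.prod_primeFactors_dvd N
  have hRsq : Squarefree R := by
    rw [hR, ← Nat.radical_eq_prod_primeFactors]
    exact UniqueFactorizationMonoid.squarefree_radical
  have hRp : R.primeFactors = N.primeFactors := Nat.primeFactors_prod_primeFactors N
  set Q : ℝ := ((Fintype.card M : ℕ) : ℝ) with hQ
  set s : ℝ := √((Fintype.card L : ℕ) : ℝ) with hs
  set A : ℕ → ℝ := fun d => #{a : Lˣ | Algebra.trace M L ((a : L) ^ (2 * d)) = β} with hA
  set h : Lˣ → ℝ := fun x => if Algebra.trace M L ((x : L) ^ 2) = β then 1 else 0 with hh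
  have hdN : ∀ d ∈ R.divisors, d ∣ N := fun d hd => (Nat.dvd_of_mem_divisors hd).trans hRN
  have hdpos : ∀ d ∈ R.divisors, 0 < d := fun d hd => Nat.pos_of_mem_divisors hd
  have hAd : ∀ d ∈ R.divisors, A d = d * ∑ x : Lˣ with d ∣ N / orderOf x, h x := by
    intro d hd
    subst hN
    rw [← IsCyclic.sum_comp_pow (hdN d hd) h]
    simp only [hA, hh, Finset.sum_boole, Units.val_pow_eq_pow_val, ← pow_mul, mul_comm 2 d]
  have hzero : ∑ d ∈ R.divisors, (ArithmeticFunction.moebius d : ℝ) * ((d : ℝ)⁻¹ * A d) = 0 := by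
    calc _ = ∑ d ∈ R.divisors, ∑ x : Lˣ,
          (if d ∣ N / orderOf x then (ArithmeticFunction.moebius d : ℝ) else 0) * h x := by
          refine Finset.sum_congr rfl fun d hd => ?_
          have : (d : ℝ) ≠ 0 := by exact_mod_cast (hdpos d hd).ne'
          rw [hAd d hd, inv_mul_cancel_left₀ this, Finset.mul_sum, Finset.sum_filter]
          refine Finset.sum_congr rfl fun x _ => ?_
          split_ifs <;> simp
      _ = ∑ x : Lˣ, (∑ d ∈ R.divisors with d ∣ N / orderOf x,
            (ArithmeticFunction.moebius d : ℝ)) * h x := by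
          rw [Finset.sum_comm]
          refine Finset.sum_congr rfl fun x _ => ?_
          rw [← Finset.sum_mul, Finset.sum_filter]
      _ = 0 := by
          refine Finset.sum_eq_zero fun x _ => ?_
          have hx : orderOf x ∣ N := hN ▸ orderOf_dvd_card
          have := sum_divisors_radical_moebius hN0 (Nat.div_dvd_of_dvd hx)
          rw [← Int.cast_sum, this]
          split_ifs with h1
          · have h2 : orderOf x = N := by
              have := Nat.div_mul_cancel hx
              rwa [h1, one_mul] at this
            simp [hh, hcon x h2]
          · simp
  have hmain : ∏ l ∈ N.primeFactors, (1 - (l : ℝ)⁻¹)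
      = ∑ d ∈ R.divisors, (ArithmeticFunction.moebius d : ℝ) * (d : ℝ)⁻¹ := by
    let f : ArithmeticFunction ℝ := ⟨fun d => (d : ℝ)⁻¹, by simp⟩
    have hf : f.IsMultiplicative := ⟨by simp [f], fun {m n} _ => by simp [f, mul_comm]⟩
    have := ArithmeticFunction.IsMultiplicative.prodPrimeFactors_one_sub_of_squarefree f hf hRsq
    rw [hRp] at this
    exact this
  have hcount : ((#R.divisors : ℕ) : ℝ) = 2 ^ #N.primeFactors := by
    have hz := ArithmeticFunction.isMultiplicative_zeta
    have := hz.prodPrimeFactors_one_add_of_squarefree hRsq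
    rw [hRp, Finset.prod_congr rfl (g := fun _ => 2) (fun l hl => by
      rw [ArithmeticFunction.zeta_apply_ne (Nat.prime_of_mem_primeFactors hl).ne_zero]),
      Finset.sum_congr rfl (g := fun _ => 1) (fun d hd => by
      rw [ArithmeticFunction.zeta_apply_ne (hdpos d hd).ne'])] at this
    simp only [Finset.prod_const, Finset.sum_const, smul_eq_mul, mul_one] at this
    exact_mod_cast this.symm
  have hE : ∀ d ∈ R.divisors, |(ArithmeticFunction.moebius d : ℝ) * ((d : ℝ)⁻¹ * (N - Q * A d))|
      ≤ 2 * ((Q - 1) * s) := by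
    intro d hd
    have hd0 : (0 : ℝ) < d := by exact_mod_cast hdpos d hd
    have hμ : |(ArithmeticFunction.moebius d : ℝ)| ≤ 1 := by
      exact_mod_cast ArithmeticFunction.abs_moebius_le_one (n := d)
    have hb := abs_card_trace_pow_eq_sub_le (L := L) β (e := 2 * d)
      (Nat.mul_pos two_pos (hdpos d hd))
    rw [hN, abs_sub_comm] at hb
    rw [abs_mul, abs_mul, abs_of_pos (inv_pos.2 hd0)]
    calc _ ≤ 1 * ((d : ℝ)⁻¹ * ((Q - 1) * ((2 * d : ℕ) * s))) := by
          gcongr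
      _ = 2 * ((Q - 1) * s) := by
          push_cast
          field_simp
  have hfin : N * ∏ l ∈ N.primeFactors, (1 - (l : ℝ)⁻¹)
      ≤ 2 * 2 ^ #N.primeFactors * ((Q - 1) * s) := by
    calc N * ∏ l ∈ N.primeFactors, (1 - (l : ℝ)⁻¹)
        = ∑ d ∈ R.divisors,
            (ArithmeticFunction.moebius d : ℝ) * ((d : ℝ)⁻¹ * (N - Q * A d)) := by
          have : ∑ d ∈ R.divisors,
              (ArithmeticFunction.moebius d : ℝ) * ((d : ℝ)⁻¹ * (N - Q * A d))
              = N * ∑ d ∈ R.divisors, (ArithmeticFunction.moebius d : ℝ) * (d : ℝ)⁻¹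
              - Q * ∑ d ∈ R.divisors, (ArithmeticFunction.moebius d : ℝ) * ((d : ℝ)⁻¹ * A d) := by
            rw [Finset.mul_sum, Finset.mul_sum, ← Finset.sum_sub_distrib]
            exact Finset.sum_congr rfl fun d _ => by ring
          rw [this, hzero, hmain, mul_zero, sub_zero]
      _ ≤ ∑ d ∈ R.divisors, 2 * ((Q - 1) * s) :=
          Finset.sum_le_sum fun d hd => (le_abs_self _).trans (hE d hd)
      _ = _ := by
          rw [Finset.sum_const, nsmul_eq_mul, hcount]
          ring
  exact absurd hlt (not_lt.2 hfin)

/-- The product `2 ^ ω(m) * m / φ(m)`, which measures the loss in the sieve. -/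
noncomputable def sieveWeight (m : ℕ) : ℝ := ∏ l ∈ m.primeFactors, (2 * l / (l - 1) : ℝ)

theorem one_le_two_mul_div_sub_one {l : ℕ} (hl : l.Prime) : (1 : ℝ) ≤ 2 * l / (l - 1) := by
  have h2 : (2 : ℝ) ≤ l := by exact_mod_cast hl.two_le
  rw [le_div_iff₀ (by linarith)]
  linarith

theorem sieveWeight_nonneg (m : ℕ) : 0 ≤ sieveWeight m :=
  Finset.prod_nonneg fun _ hl =>
    zero_le_one.trans (one_le_two_mul_div_sub_one (Nat.prime_of_mem_primeFactors hl))

theorem sieveWeight_mul_le {a b : ℕ} (ha : a ≠ 0) (hb : b ≠ 0) :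
    sieveWeight (a * b) ≤ sieveWeight a * sieveWeight b := by
  have hab := sieveWeight_nonneg (a * b)
  unfold sieveWeight at *
  rw [← Finset.prod_union_inter, Nat.primeFactors_mul ha hb] at *
  refine le_mul_of_one_le_right hab (Finset.one_le_prod fun l hl => ?_)
  exact one_le_two_mul_div_sub_one (Nat.prime_of_mem_primeFactors (Finset.mem_inter.1 hl).1)

theorem sieveWeight_mul_prod (m : ℕ) :
    sieveWeight m * ∏ l ∈ m.primeFactors, (1 - (l : ℝ)⁻¹) = 2 ^ #m.primeFactors := by
  rw [sieveWeight, ← Finset.prod_mul_distrib, ← Finset.prod_const]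
  refine Finset.prod_congr rfl fun l hl => ?_
  have h2 : (2 : ℝ) ≤ l := by exact_mod_cast (Nat.prime_of_mem_primeFactors hl).two_le
  have h1 : (l : ℝ) - 1 ≠ 0 := by linarith
  field_simp

theorem sieveWeight_le {m : ℕ} (hm : m ≠ 0) : sieveWeight m ≤ 2 * m := by
  calc sieveWeight m ≤ ∏ l ∈ m.primeFactors, (if l = 2 then 2 else 1) * (l : ℝ) := by
        refine Finset.prod_le_prod (fun l hl => zero_le_one.trans
          (one_le_two_mul_div_sub_one (Nat.prime_of_mem_primeFactors hl))) fun l hl => ?_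
        have hlp := Nat.prime_of_mem_primeFactors hl
        split_ifs with h
        · subst h
          norm_num
        · have h3 : (3 : ℝ) ≤ l := by exact_mod_cast lt_of_le_of_ne hlp.two_le (Ne.symm h)
          rw [div_le_iff₀ (by linarith)]
          nlinarith
    _ = (if 2 ∈ m.primeFactors then 2 else 1) * ((∏ l ∈ m.primeFactors, l : ℕ) : ℝ) := by
        rw [Finset.prod_mul_distrib, Finset.prod_ite_eq', Nat.cast_prod]
    _ ≤ 2 * m := by
        have h1 : ((∏ l ∈ m.primeFactors, l : ℕ) : ℝ) ≤ m := by
          exact_mod_cast Nat.le_of_dvd (Nat.pos_of_ne_zero hm) (Nat.prod_primeFactors_dvd m)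
        gcongr
        split_ifs <;> norm_num

theorem sieveWeight_le_of_four_dvd {m : ℕ} (hm : m ≠ 0) (h4 : 4 ∣ m) : sieveWeight m ≤ m := by
  obtain ⟨c, rfl⟩ := h4
  have hc : c ≠ 0 := by
    rintro rfl
    simp at hm
  have h2 : sieveWeight (4 * c) = sieveWeight (2 * c) := by
    have : (4 * c).primeFactors = (2 * c).primeFactors := by
      rw [show 4 * c = 2 * (2 * c) by ring, Nat.primeFactors_mul two_ne_zero (by simpa using hc),
        Finset.union_eq_right]
      exact Nat.primeFactors_mono (Dvd.intro c rfl) (by simpa using hc)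
    rw [sieveWeight, this, sieveWeight]
  rw [h2]
  refine (sieveWeight_le (by simpa using hc)).trans_eq ?_
  push_cast
  ring

theorem sieveWeight_pow_four_le {m : ℕ} (hm : m ≠ 0)
    (h : ∀ l ∈ m.primeFactors, l = 11 ∨ 23 ≤ l) : sieveWeight m ^ 4 ≤ 2.13 * m := by
  calc sieveWeight m ^ 4 ≤ ∏ l ∈ m.primeFactors, (if l = 11 then 2.13 else 1) * (l : ℝ) := by
        rw [sieveWeight, ← Finset.prod_pow]
        refine Finset.prod_le_prod (fun l hl => by positivity) fun l hl => ?_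
        split_ifs with h11
        · subst h11
          norm_num
        · have h23 : (23 : ℝ) ≤ l := by exact_mod_cast (h l hl).resolve_left h11
          have hle : (2 * l / (l - 1) : ℝ) ≤ 46 / 22 := by
            rw [div_le_div_iff₀ (by linarith) (by norm_num)]
            linarith
          have h0 : (0 : ℝ) ≤ 2 * l / (l - 1) := div_nonneg (by linarith) (by linarith)
          calc (2 * l / (l - 1) : ℝ) ^ 4 ≤ (46 / 22 : ℝ) ^ 4 := by gcongr
            _ ≤ 1 * (l : ℝ) := le_trans (by norm_num) (h23.trans_eq (one_mul _).symm)
    _ = (if 11 ∈ m.primeFactors then 2.13 else 1) * ((∏ l ∈ m.primeFactors, l : ℕ) : ℝ) := by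
        rw [Finset.prod_mul_distrib, Finset.prod_ite_eq', Nat.cast_prod]
    _ ≤ 2.13 * m := by
        have h1 : ((∏ l ∈ m.primeFactors, l : ℕ) : ℝ) ≤ m := by
          exact_mod_cast Nat.le_of_dvd (Nat.pos_of_ne_zero hm) (Nat.prod_primeFactors_dvd m)
        gcongr
        split_ifs <;> norm_num

/-- A prime factor of `1 + r + ⋯ + r ^ (p ^ j - 1)`, where `p ∣ r`, is congruent to `1` mod `p`. -/
theorem dvd_sub_one_of_dvd_geom_sum {p r j l : ℕ} (hp : p.Prime) (hpr : p ∣ r) (hl : l.Prime)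
    (h : l ∣ ∑ i ∈ Finset.range (p ^ j), r ^ i) : p ∣ l - 1 := by
  have := Fact.mk hl
  have hsum : ∑ i ∈ Finset.range (p ^ j), (r : ZMod l) ^ i = 0 := by
    have := (ZMod.natCast_eq_zero_iff _ _).2 h
    exact_mod_cast this
  have hpow : (r : ZMod l) ^ p ^ j = 1 := by
    have := geom_sum_mul (r : ZMod l) (p ^ j)
    rw [hsum, zero_mul] at this
    exact (sub_eq_zero.1 this.symm)
  have hj : j ≠ 0 := by
    rintro rfl
    simp at hsum
  have hr0 : (r : ZMod l) ≠ 0 := by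
    intro h0
    rw [h0, zero_pow (pow_ne_zero _ hp.ne_zero)] at hpow
    exact zero_ne_one hpow
  have hne : (r : ZMod l) ≠ 1 := by
    intro h1
    simp only [h1, one_pow, Finset.sum_const, Finset.card_range, nsmul_eq_mul, mul_one] at hsum
    have h2 : l ∣ p ^ j := (ZMod.natCast_eq_zero_iff _ _).1 hsum
    have h3 : l = p := (Nat.prime_dvd_prime_iff_eq hl hp).1 (hl.dvd_of_dvd_pow h2)
    exact hr0 ((ZMod.natCast_eq_zero_iff _ _).2 (h3 ▸ hpr))
  obtain ⟨i, -, hi⟩ := (Nat.dvd_prime_pow hp).1 (orderOf_dvd_of_pow_eq_one hpow)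
  have hi0 : i ≠ 0 := by
    rintro rfl
    rw [pow_zero, orderOf_eq_one_iff] at hi
    exact hne hi
  exact (dvd_pow_self p hi0).trans (hi ▸ ZMod.orderOf_dvd_card_sub_one hr0)

theorem eq_eleven_or_le_of_dvd_sub_one {p l : ℕ} (hp : p.Prime) (hp5 : 5 ≤ p) (hl : l.Prime)
    (h : p ∣ l - 1) : l = 11 ∨ 23 ≤ l := by
  by_contra! hcon
  obtain ⟨h11, h23⟩ := hcon
  have hl2 := hl.two_le
  have hple : p ≤ l - 1 := Nat.le_of_dvd (by omega) h
  have : p ≤ 21 := by omega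
  interval_cases l <;> interval_cases p <;> revert hp hl h <;> simp_all <;> norm_num

theorem mul_sub_one_pow_three_le {x : ℝ} (hx : 5 ≤ x) : 16 * 2.13 * (x - 1) ^ 3 ≤ x ^ 5 := by
  obtain ⟨y, rfl⟩ : ∃ y, x = y + 5 := ⟨x - 5, by ring⟩
  have hy : 0 ≤ y := by linarith
  have h : 0 ≤ y ^ 5 + 25 * y ^ 4 + 215.92 * y ^ 3 + 841.04 * y ^ 2 + 1489.16 * y + 943.88 := by
    positivity
  linear_combination h

theorem sixteen_mul_sieveWeight_pow_four_le {p a : ℕ} (hp : p.Prime) (hp5 : 5 ≤ p)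
    (ha : a ≠ 0) :
    16 * sieveWeight ((p ^ a) ^ (p ^ 2) - 1) ^ 4 ≤ ((p ^ a : ℕ) : ℝ) ^ (p * (2 * p - 4)) := by
  set r := p ^ a with hr
  have hpr : p ∣ r := dvd_pow_self p ha
  have hr5 : 5 ≤ r := hp5.trans (Nat.le_of_dvd (pow_pos hp.pos _) hpr)
  set m := ∑ i ∈ Finset.range (p ^ 2), r ^ i with hm
  have hfac : m * (r - 1) = r ^ (p ^ 2) - 1 := geom_sum_mul_of_one_le (by omega) _
  have hr1 : r - 1 ≠ 0 := by omega
  have hm0 : m ≠ 0 := by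
    intro h
    rw [h, zero_mul] at hfac
    have := Nat.one_lt_pow (pow_ne_zero 2 hp.ne_zero) (show 1 < r by omega)
    omega
  have hsm : sieveWeight m ^ 4 ≤ 2.13 * m := sieveWeight_pow_four_le hm0 fun l hl =>
    have hlp := Nat.prime_of_mem_primeFactors hl
    eq_eleven_or_le_of_dvd_sub_one hp hp5 hlp
      (dvd_sub_one_of_dvd_geom_sum hp hpr hlp (Nat.dvd_of_mem_primeFactors hl))
  set x : ℝ := (r : ℝ) with hx
  have hx5 : 5 ≤ x := by
    rw [hx]
    exact_mod_cast hr5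
  have hcast : ((r - 1 : ℕ) : ℝ) = x - 1 := by
    rw [Nat.cast_sub (by omega), Nat.cast_one]
  have hmx : (m : ℝ) * (x - 1) ≤ x ^ (p ^ 2) := by
    rw [← hcast, hx]
    exact_mod_cast hfac.le.trans (Nat.sub_le _ _)
  have hreduce : ∀ c : ℝ, 0 ≤ c → sieveWeight (r - 1) ≤ c * (x - 1) →
      16 * 2.13 * c ^ 4 * (x - 1) ^ 3 * x ^ (p ^ 2) ≤ x ^ (p * (2 * p - 4)) →
      16 * sieveWeight (r ^ (p ^ 2) - 1) ^ 4 ≤ x ^ (p * (2 * p - 4)) := by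
    intro c hc hle hfinal
    have h1 : sieveWeight (r ^ (p ^ 2) - 1) ≤ sieveWeight m * (c * (x - 1)) := by
      rw [← hfac]
      refine (sieveWeight_mul_le hm0 hr1).trans ?_
      gcongr
      exact sieveWeight_nonneg _
    have h0 : 0 ≤ x - 1 := by linarith
    refine le_trans ?_ hfinal
    calc 16 * sieveWeight (r ^ (p ^ 2) - 1) ^ 4 ≤ 16 * (sieveWeight m * (c * (x - 1))) ^ 4 := by
          gcongr
          exact sieveWeight_nonneg _
      _ = 16 * (c * (x - 1)) ^ 4 * sieveWeight m ^ 4 := by ring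
      _ ≤ 16 * (c * (x - 1)) ^ 4 * (2.13 * m) := by gcongr
      _ = 16 * 2.13 * c ^ 4 * (x - 1) ^ 3 * (m * (x - 1)) := by ring
      _ ≤ _ := by gcongr
  rcases hp5.eq_or_lt with rfl | hp6
  · refine hreduce 1 zero_le_one ?_ ?_
    · rw [one_mul, ← hcast]
      refine sieveWeight_le_of_four_dvd hr1 ?_
      have := Nat.sub_dvd_pow_sub_pow 5 1 a
      rwa [one_pow] at this
    · have key := mul_sub_one_pow_three_le hx5
      calc 16 * 2.13 * 1 ^ 4 * (x - 1) ^ 3 * x ^ (5 ^ 2)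
          = (16 * 2.13 * (x - 1) ^ 3) * x ^ 25 := by norm_num
        _ ≤ x ^ 5 * x ^ 25 := by gcongr
        _ = _ := by rw [← pow_add]
  · refine hreduce 2 zero_le_two (by rw [← hcast]; exact sieveWeight_le hr1) ?_
    obtain ⟨c, rfl⟩ := Nat.exists_eq_add_of_le hp6
    have hexp : 5 + 3 + (5 + 1 + c) ^ 2 ≤ (5 + 1 + c) * (2 * (5 + 1 + c) - 4) := by
      rw [show 2 * (5 + 1 + c) - 4 = 8 + 2 * c by omega]
      nlinarith
    have h5 : (16 * 2.13 * 2 ^ 4 : ℝ) ≤ x ^ 5 :=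
      le_trans (by norm_num) (pow_le_pow_left₀ (by norm_num) hx5 5)
    have h0 : 0 ≤ x - 1 := by linarith
    calc 16 * 2.13 * 2 ^ 4 * (x - 1) ^ 3 * x ^ (5 + 1 + c) ^ 2
        ≤ x ^ 5 * x ^ 3 * x ^ (5 + 1 + c) ^ 2 := by
          gcongr
          linarith
      _ = x ^ (5 + 3 + (5 + 1 + c) ^ 2) := by rw [pow_add, pow_add]
      _ ≤ _ := pow_le_pow_right₀ (by linarith) hexp

theorem two_mul_sieveWeight_mul_lt {p a : ℕ} (hp : p.Prime) (hp5 : 5 ≤ p) (ha : a ≠ 0)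
    {Q : ℕ} (hQ : Q = (p ^ a) ^ p) :
    2 * sieveWeight (Q ^ p - 1) * ((Q - 1) * √((Q ^ p : ℕ) : ℝ)) < ((Q ^ p - 1 : ℕ) : ℝ) := by
  have hQ1 : 1 < Q := by
    rw [hQ, ← pow_mul]
    exact Nat.one_lt_pow (mul_ne_zero ha hp.ne_zero) hp.one_lt
  have hQ1' : (1 : ℝ) < Q := by exact_mod_cast hQ1
  have hbound := sixteen_mul_sieveWeight_pow_four_le hp hp5 ha
  have hexp : (p ^ a) ^ p ^ 2 = Q ^ p := by rw [hQ, ← pow_mul _ p p, sq]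
  have hexp' : ((p ^ a : ℕ) : ℝ) ^ (p * (2 * p - 4)) = (Q : ℝ) ^ (2 * p - 4) := by
    rw [hQ, pow_mul]
    push_cast
    rfl
  rw [hexp, hexp'] at hbound
  set W := sieveWeight (Q ^ p - 1) with hW
  have hW0 : 0 ≤ W := sieveWeight_nonneg _
  set s : ℝ := √((Q ^ p : ℕ) : ℝ) with hs
  have hs0 : 0 ≤ s := Real.sqrt_nonneg _
  have hs2 : s ^ 2 = (Q : ℝ) ^ p := by
    rw [hs, Real.sq_sqrt (by positivity), Nat.cast_pow]
  have hWs : 2 * W * Q ≤ s := by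
    refine le_of_pow_le_pow_left₀ (n := 4) (by norm_num) hs0 ?_
    calc (2 * W * Q) ^ 4 = 16 * W ^ 4 * (Q : ℝ) ^ 4 := by ring
      _ ≤ (Q : ℝ) ^ (2 * p - 4) * (Q : ℝ) ^ 4 := by gcongr
      _ = (Q : ℝ) ^ (p * 2) := by
          rw [← pow_add]
          congr 1
          omega
      _ = s ^ 4 := by rw [pow_mul, ← hs2]; ring
  have hsQ : (Q : ℝ) < s ^ 2 := by
    rw [hs2]
    exact lt_self_pow₀ hQ1' (by omega)
  have hN : ((Q ^ p - 1 : ℕ) : ℝ) = s ^ 2 - 1 := by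
    rw [Nat.cast_sub (Nat.one_le_pow _ _ (by omega)), hs2]
    push_cast
    rfl
  rw [hN]
  refine lt_of_mul_lt_mul_right ?_ (show (0 : ℝ) ≤ Q by positivity)
  calc 2 * W * ((Q - 1) * s) * Q = (2 * W * Q) * ((Q - 1) * s) := by ring
    _ ≤ s * ((Q - 1) * s) := by
        have : (0 : ℝ) ≤ Q - 1 := by linarith
        gcongr
    _ < (s ^ 2 - 1) * Q := by linarith


/-- Let `p ≥ 5` be prime, `q` a power of `p`, and `n = p^k u` with `gcd(u, p) = 1` and `k ≥ 2`.
Then for every `β ∈ F_{q^{n/p}}` there exists a `2`-primitive `α ∈ F_{q^n}` with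
`Tr_{F_{q^n}/F_{q^{n/p}}}(α) = β`. -/
theorem stmt_9 (p t q n k u : ℕ) (hp : p.Prime) (hp5 : 5 ≤ p) (ht : 1 ≤ t) (hq : q = p ^ t)
    (hk : 2 ≤ k) (hgcd : Nat.gcd u p = 1) (hn : n = p ^ k * u)
    (K M L : Type*) [Field K] [Field M] [Field L] [Algebra K M] [Algebra M L] [Algebra K L]
    [IsScalarTower K M L] [Fintype K] [Fintype M] [Fintype L]
    (hK : Fintype.card K = q) (hM : Fintype.card M = q ^ (n / p))
    (hL : Fintype.card L = q ^ n) :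
    ∀ β : M, ∃ α : L, orderOf α = (q ^ n - 1) / 2 ∧ Algebra.trace M L α = β := by
  intro β
  classical
  obtain ⟨j, rfl⟩ := Nat.exists_eq_add_of_le hk
  have hu : u ≠ 0 := by
    rintro rfl
    rw [Nat.gcd_zero_left] at hgcd
    omega
  set b := p ^ j * u with hb
  have hb0 : b ≠ 0 := mul_ne_zero (pow_ne_zero _ hp.ne_zero) hu
  have hnb : n = p * b * p := by
    rw [hn, hb]
    ring
  have hnp : n / p = p * b := by rw [hnb, Nat.mul_div_cancel _ hp.pos]
  have hQ : Fintype.card M = (p ^ (t * b)) ^ p := by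
    rw [hM, hnp, hq, ← pow_mul, ← pow_mul]
    congr 1
    ring
  have hcardL : Fintype.card L = Fintype.card M ^ p := by
    rw [hL, hM, hnp, ← pow_mul, hnb]
  have hunits : Fintype.card Lˣ = Fintype.card M ^ p - 1 := by
    rw [Fintype.card_units, hcardL]
  set N := Fintype.card M ^ p - 1 with hN
  have hprod : (0 : ℝ) < ∏ l ∈ N.primeFactors, (1 - (l : ℝ)⁻¹) := by
    refine Finset.prod_pos fun l hl => sub_pos.2 (inv_lt_one_of_one_lt₀ ?_)
    exact_mod_cast (Nat.prime_of_mem_primeFactors hl).one_lt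
  have hlt := two_mul_sieveWeight_mul_lt hp hp5 (mul_ne_zero (by omega) hb0) hQ
  obtain ⟨γ, hγ, hγβ⟩ := exists_primitive_trace_sq_eq (L := L) hunits (by
    rw [hcardL, ← sieveWeight_mul_prod]
    refine lt_of_eq_of_lt ?_ (mul_lt_mul_of_pos_right hlt hprod)
    ring) β
  refine ⟨(γ : L) ^ 2, ?_, hγβ⟩
  have hodd : Odd (Fintype.card M ^ p) := by
    rw [hQ]
    exact ((hp.odd_of_ne_two (by omega)).pow.pow).pow
  have h2N : 2 ∣ N := (Nat.Odd.sub_odd hodd odd_one).two_dvd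
  rw [orderOf_pow_of_dvd two_ne_zero (by rwa [orderOf_units, hγ]), orderOf_units, hγ, hN,
    ← hcardL, hL]
end
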